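/- Let N ≥ 3, 0 < μ < μ₀ = (N-2)²/4, and let V ∈ C^γ_loc(ℝ^N∖{0}) (γ ∈ (0,1)) be a positive potential with V(x) ≥ |x|^{-2} for all x ≠ 0 and lim_{x→0} V(x)|x|² = 1. If u is a classical solution of -Δu - μVu = 0 in ℝ^N∖{0} that is nonnegative on ℝ^N∖{0} and satisfies the dμ-distributional identity with a constant k > 0, then u(x) ≥ k|x|^{τ₋(μ)} for all x ∈ ℝ^N∖{0}. -/

import Mathlib

open Filter MeasureTheory Metric

noncomputable section

/-- Euclidean space ℝ^N. -/
abbrev Euc (N : ℕ) : Type := EuclideanSpace ℝ (Fin N)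

/-- The Laplacian of `u` at `x`, as the sum of the pure second derivatives in the
coordinate directions. -/
def lap {N : ℕ} (u : Euc N → ℝ) (x : Euc N) : ℝ :=
  ∑ i : Fin N, fderiv ℝ (fun y => fderiv ℝ u y (EuclideanSpace.single i 1)) x
    (EuclideanSpace.single i 1)

/-- μ₀ = (N-2)²/4. -/
def mu0 (N : ℕ) : ℝ := ((N : ℝ) - 2) ^ 2 / 4

/-- τ₋(μ) = -(N-2)/2 - √(μ₀-μ). -/
def tauMinus (N : ℕ) (μ : ℝ) : ℝ := -((N : ℝ) - 2) / 2 - Real.sqrt (mu0 N - μ)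

/-- τ₊(μ) = -(N-2)/2 + √(μ₀-μ). -/
def tauPlus (N : ℕ) (μ : ℝ) : ℝ := -((N : ℝ) - 2) / 2 + Real.sqrt (mu0 N - μ)

/-- Surface area of the unit sphere in ℝ^N, i.e. N times the volume of the unit ball. -/
def sphereArea (N : ℕ) : ℝ := N * (volume (ball (0 : Euc N) 1)).toReal

/-- The normalizing constant c_μ: 2√(μ₀-μ)|𝕊^{N-1}| for μ < μ₀ and |𝕊^{N-1}| for μ = μ₀. -/
def cMu (N : ℕ) (μ : ℝ) : ℝ :=
  if μ < mu0 N then 2 * Real.sqrt (mu0 N - μ) * sphereArea N else sphereArea N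

/-- The normalizing constant c_N = ((N-2)|𝕊^{N-1}|)⁻¹ of the fundamental solution of -Δ. -/
def cN (N : ℕ) : ℝ := (((N : ℝ) - 2) * sphereArea N)⁻¹

/-- The singular profile Φ_μ: |x|^{τ₋(μ)} for μ < μ₀ and |x|^{-(N-2)/2}(-ln|x|) for μ = μ₀. -/
def PhiFun (N : ℕ) (μ : ℝ) (x : Euc N) : ℝ :=
  if μ < mu0 N then ‖x‖ ^ tauMinus N μ
  else ‖x‖ ^ (-((N : ℝ) - 2) / 2) * (-Real.log ‖x‖)

/-- The adjoint operator L*_μ ξ(x) = -Δξ(x) - 2τ₊(μ)|x|⁻² x·∇ξ(x). -/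
def LstarMu (N : ℕ) (μ : ℝ) (ξ : Euc N → ℝ) (x : Euc N) : ℝ :=
  -lap ξ x - 2 * tauPlus N μ / ‖x‖ ^ 2 * fderiv ℝ ξ x x

/-- The adjoint operator L*_{μV} ξ = L*_μ ξ - μ(V - |x|⁻²)ξ. -/
def LstarMuV (N : ℕ) (μ : ℝ) (V ξ : Euc N → ℝ) (x : Euc N) : ℝ :=
  LstarMu N μ ξ x - μ * (V x - ‖x‖ ^ (-2 : ℝ)) * ξ x

/-- A compactly supported C^{1,1} test function: compactly supported, differentiable,
with Lipschitz gradient. -/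
def IsC11c {N : ℕ} (ξ : Euc N → ℝ) : Prop :=
  HasCompactSupport ξ ∧ Differentiable ℝ ξ ∧ ∃ L : NNReal, LipschitzWith L (fderiv ℝ ξ)

/-- The dμ-distributional identity with constant `k`. -/
def DistribIdentity (N : ℕ) (μ : ℝ) (V u : Euc N → ℝ) (k : ℝ) : Prop :=
  ∀ ξ : Euc N → ℝ, IsC11c ξ →
    ∫ x : Euc N, u x * LstarMuV N μ V ξ x * ‖x‖ ^ tauPlus N μ = cMu N μ * k * ξ 0

/-- `u` is a classical solution of -Δu - μVu = 0 in ℝ^N∖{0}. -/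
def IsSolution (N : ℕ) (μ : ℝ) (V u : Euc N → ℝ) : Prop :=
  ContDiffOn ℝ 2 u {x : Euc N | x ≠ 0} ∧
  ∀ x : Euc N, x ≠ 0 → -lap u x - μ * V x * u x = 0

/-- `f` is locally γ-Hölder continuous on `s`. -/
def LocHolderOn {N : ℕ} (γ : ℝ) (s : Set (Euc N)) (f : Euc N → ℝ) : Prop :=
  ∀ x ∈ s, ∃ ε > 0, ∃ C > 0, ∀ y ∈ ball x ε ∩ s, ∀ z ∈ ball x ε ∩ s,
    |f y - f z| ≤ C * dist y z ^ γ

/-- The filter `‖x‖ → +∞` on ℝ^N. -/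
def normAtTop (N : ℕ) : Filter (Euc N) := comap norm atTop

/-- Assumption (V): V is locally Hölder and positive on ℝ^N∖{0},
0 ≤ V(x) - |x|⁻² ≤ c₀, and limsup_{|x|→∞} V(x)|x|² = α. -/
def AssumpV (N : ℕ) (V : Euc N → ℝ) (α : ℝ) : Prop :=
  (∃ γ : ℝ, 0 < γ ∧ γ < 1 ∧ LocHolderOn γ {x : Euc N | x ≠ 0} V) ∧
  (∀ x : Euc N, x ≠ 0 → 0 < V x) ∧
  (∃ c₀ : ℝ, 0 < c₀ ∧ ∀ x : Euc N, x ≠ 0 →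
    0 ≤ V x - ‖x‖ ^ (-2 : ℝ) ∧ V x - ‖x‖ ^ (-2 : ℝ) ≤ c₀) ∧
  limsup (fun x : Euc N => V x * ‖x‖ ^ 2) (normAtTop N) = α

/-- Assumption (Ṽ): V is locally Hölder and positive on ℝ^N∖{0},
0 ≤ V(x) - |x|⁻² ≤ c₀, and liminf_{|x|→∞} V(x)|x|² = β. -/
def AssumpVtilde (N : ℕ) (V : Euc N → ℝ) (β : ℝ) : Prop :=
  (∃ γ : ℝ, 0 < γ ∧ γ < 1 ∧ LocHolderOn γ {x : Euc N | x ≠ 0} V) ∧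
  (∀ x : Euc N, x ≠ 0 → 0 < V x) ∧
  (∃ c₀ : ℝ, 0 < c₀ ∧ ∀ x : Euc N, x ≠ 0 →
    0 ≤ V x - ‖x‖ ^ (-2 : ℝ) ∧ V x - ‖x‖ ^ (-2 : ℝ) ≤ c₀) ∧
  liminf (fun x : Euc N => V x * ‖x‖ ^ 2) (normAtTop N) = β

/-- The potential V_ρ(x) = |x|⁻²(1 + ρ|x|²)/(1 + |x|²). -/
def Vrho (N : ℕ) (ρ : ℝ) (x : Euc N) : ℝ :=
  ‖x‖ ^ (-2 : ℝ) * (1 + ρ * ‖x‖ ^ 2) / (1 + ‖x‖ ^ 2)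

/-- Ω has C² boundary: it is the sublevel set of a C² function whose differential
does not vanish on the boundary. -/
def HasC2Boundary {N : ℕ} (Ω : Set (Euc N)) : Prop :=
  ∃ φ : Euc N → ℝ, ContDiff ℝ 2 φ ∧ Ω = {x | φ x < 0} ∧
    ∀ x ∈ frontier Ω, fderiv ℝ φ x ≠ 0

open scoped Topology

theorem contDiffAt_fderiv_apply {N : ℕ} {u : Euc N → ℝ} {x : Euc N} (hu : ContDiffAt ℝ 2 u x)
    (v : Euc N) : ContDiffAt ℝ 1 (fun y => fderiv ℝ u y v) x :=
  (hu.fderiv_right (m := 1) (by norm_num)).clm_apply contDiffAt_const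

theorem eventually_differentiableAt {N : ℕ} {u : Euc N → ℝ} {x : Euc N}
    (hu : ContDiffAt ℝ 2 u x) : ∀ᶠ y in 𝓝 x, DifferentiableAt ℝ u y :=
  (hu.eventually (by simp)).mono fun _ hy => hy.differentiableAt (by simp)

theorem lap_congr {N : ℕ} {u v : Euc N → ℝ} {x : Euc N} (h : u =ᶠ[𝓝 x] v) : lap u x = lap v x := by
  unfold lap
  refine Finset.sum_congr rfl fun i _ => ?_
  have : (fun y => fderiv ℝ u y (EuclideanSpace.single i 1)) =ᶠ[𝓝 x]
      (fun y => fderiv ℝ v y (EuclideanSpace.single i 1)) :=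
    (h.fderiv (𝕜 := ℝ)).mono fun y hy => congrArg (fun A => A (EuclideanSpace.single i 1)) hy
  rw [this.fderiv_eq]

theorem lap_sub_const_mul {N : ℕ} {u v : Euc N → ℝ} {x : Euc N} (hu : ContDiffAt ℝ 2 u x)
    (hv : ContDiffAt ℝ 2 v x) (c : ℝ) :
    lap (fun y => u y - c * v y) x = lap u x - c * lap v x := by
  unfold lap
  rw [Finset.mul_sum, ← Finset.sum_sub_distrib]
  refine Finset.sum_congr rfl fun i _ => ?_
  have : (fun y => fderiv ℝ (fun y => u y - c * v y) y (EuclideanSpace.single i 1)) =ᶠ[𝓝 x]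
      (fun y => fderiv ℝ u y (EuclideanSpace.single i 1) -
        c * fderiv ℝ v y (EuclideanSpace.single i 1)) := by
    filter_upwards [eventually_differentiableAt hu, eventually_differentiableAt hv] with y h1 h2
    rw [fderiv_fun_sub h1 (h2.const_mul c), fderiv_const_mul h2]
    simp
  have h1 := (contDiffAt_fderiv_apply hu (EuclideanSpace.single i 1)).differentiableAt (by simp)
  have h2 := (contDiffAt_fderiv_apply hv (EuclideanSpace.single i 1)).differentiableAt (by simp)
  rw [this.fderiv_eq, fderiv_fun_sub h1 (h2.const_mul c), fderiv_const_mul h2]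
  simp

theorem lap_comp {N : ℕ} {G : Euc N → ℝ} {x : Euc N} (hG : ContDiffAt ℝ 2 G x)
    {g g₁ : ℝ → ℝ} {g₂ : ℝ} (hg : ∀ᶠ t in 𝓝 (G x), HasDerivAt g (g₁ t) t)
    (hg₁ : HasDerivAt g₁ g₂ (G x)) :
    lap (fun y => g (G y)) x =
      g₂ * ∑ i, fderiv ℝ G x (EuclideanSpace.single i 1) ^ 2 + g₁ (G x) * lap G x := by
  unfold lap
  rw [Finset.mul_sum, Finset.mul_sum, ← Finset.sum_add_distrib]
  refine Finset.sum_congr rfl fun i _ => ?_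
  have : (fun y => fderiv ℝ (fun y => g (G y)) y (EuclideanSpace.single i 1)) =ᶠ[𝓝 x]
      (fun y => g₁ (G y) * fderiv ℝ G y (EuclideanSpace.single i 1)) := by
    filter_upwards [eventually_differentiableAt hG, hG.continuousAt.eventually hg] with y h1 h2
    have := (h2.comp_hasFDerivAt y h1.hasFDerivAt).fderiv
    simp only [Function.comp_def] at this
    rw [this]
    simp
  have h1 := hG.differentiableAt (by simp)
  have h2 := (contDiffAt_fderiv_apply hG (EuclideanSpace.single i 1)).differentiableAt (by simp)
  have h3 := hg₁.comp_hasFDerivAt x h1.hasFDerivAt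
  have h4 := h3.fun_mul h2.hasFDerivAt
  simp only [Function.comp_def] at h4
  rw [this.fderiv_eq, HasFDerivAt.fderiv h4]
  simp
  ring

theorem fderiv_normSq_sub_add {N : ℕ} (c : Euc N) (a : ℝ) (x v : Euc N) :
    fderiv ℝ (fun y : Euc N => ‖y - c‖ ^ 2 + a) x v = 2 * inner ℝ (x - c) v := by
  have h := ((hasFDerivAt_id x).sub_const c).norm_sq.add_const a
  simp only [id_eq] at h
  rw [HasFDerivAt.fderiv h]
  simp [inner_sub_left]

theorem lap_normSq_sub_add {N : ℕ} (c : Euc N) (a : ℝ) (x : Euc N) :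
    lap (fun y : Euc N => ‖y - c‖ ^ 2 + a) x = 2 * N := by
  unfold lap
  have (i : Fin N) : fderiv ℝ (fun y => fderiv ℝ (fun y : Euc N => ‖y - c‖ ^ 2 + a) y
      (EuclideanSpace.single i 1)) x (EuclideanSpace.single i 1) = 2 := by
    simp_rw [fderiv_normSq_sub_add]
    have h := (((hasFDerivAt_id x).sub_const c).inner ℝ
      (hasFDerivAt_const (EuclideanSpace.single i (1 : ℝ)) x)).const_mul 2
    simp only [id_eq] at h
    rw [HasFDerivAt.fderiv h]
    simp
  simp_rw [this]
  simp [mul_comm]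

theorem sum_sq_fderiv_normSq_sub_add {N : ℕ} (c : Euc N) (a : ℝ) (x : Euc N) :
    ∑ i, fderiv ℝ (fun y : Euc N => ‖y - c‖ ^ 2 + a) x (EuclideanSpace.single i 1) ^ 2 =
      4 * ‖x - c‖ ^ 2 := by
  simp_rw [fderiv_normSq_sub_add, EuclideanSpace.norm_sq_eq, Finset.mul_sum]
  refine Finset.sum_congr rfl fun i _ => ?_
  simp [EuclideanSpace.inner_single_right]
  ring

theorem contDiff_normSq_sub_add {N : ℕ} (c : Euc N) (a : ℝ) :
    ContDiff ℝ 2 (fun y : Euc N => ‖y - c‖ ^ 2 + a) :=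
  ((contDiff_id.sub contDiff_const).norm_sq ℝ).add contDiff_const

/-- The Laplacian of a radial function of the shifted squared distance to `c`. -/
theorem lap_radial {N : ℕ} (c : Euc N) (a : ℝ) (x : Euc N) {g g₁ : ℝ → ℝ} {g₂ : ℝ}
    (hg : ∀ᶠ t in 𝓝 (‖x - c‖ ^ 2 + a), HasDerivAt g (g₁ t) t)
    (hg₁ : HasDerivAt g₁ g₂ (‖x - c‖ ^ 2 + a)) :
    lap (fun y => g (‖y - c‖ ^ 2 + a)) x =
      4 * ‖x - c‖ ^ 2 * g₂ + 2 * N * g₁ (‖x - c‖ ^ 2 + a) := by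
  rw [lap_comp (contDiff_normSq_sub_add c a).contDiffAt hg hg₁, lap_normSq_sub_add,
    sum_sq_fderiv_normSq_sub_add]
  ring

theorem fderiv_radial_apply {N : ℕ} (c : Euc N) (a : ℝ) (x v : Euc N) {g : ℝ → ℝ} {g' : ℝ}
    (hg : HasDerivAt g g' (‖x - c‖ ^ 2 + a)) :
    fderiv ℝ (fun y => g (‖y - c‖ ^ 2 + a)) x v = g' * (2 * inner ℝ (x - c) v) := by
  have h := hg.comp_hasFDerivAt x
    ((contDiff_normSq_sub_add c a).differentiable (by simp) x).hasFDerivAt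
  simp only [Function.comp_def] at h
  rw [h.fderiv, ← fderiv_normSq_sub_add c a]
  simp

theorem sum_sq_fderiv_radial {N : ℕ} (c : Euc N) (a : ℝ) (x : Euc N) {g : ℝ → ℝ} {g' : ℝ}
    (hg : HasDerivAt g g' (‖x - c‖ ^ 2 + a)) :
    ∑ i, fderiv ℝ (fun y => g (‖y - c‖ ^ 2 + a)) x (EuclideanSpace.single i 1) ^ 2 =
      4 * ‖x - c‖ ^ 2 * g' ^ 2 := by
  simp_rw [fderiv_radial_apply c a x _ hg, mul_pow g', ← Finset.mul_sum]
  simp_rw [← fderiv_normSq_sub_add c a, sum_sq_fderiv_normSq_sub_add]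
  ring

/-- `lap` of the power `(‖y - c‖² + a) ^ p`. -/
theorem lap_rpow {N : ℕ} (c : Euc N) (a p : ℝ) (x : Euc N) (h : 0 < ‖x - c‖ ^ 2 + a) :
    lap (fun y => (‖y - c‖ ^ 2 + a) ^ p) x =
      4 * ‖x - c‖ ^ 2 * (p * ((p - 1) * (‖x - c‖ ^ 2 + a) ^ (p - 2))) +
        2 * N * (p * (‖x - c‖ ^ 2 + a) ^ (p - 1)) := by
  refine lap_radial (g := fun t => t ^ p) (g₁ := fun t => p * t ^ (p - 1)) c a x ?_ ?_
  · filter_upwards [lt_mem_nhds h] with t ht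
    exact Real.hasDerivAt_rpow_const (Or.inl ht.ne')
  · have h2 := (Real.hasDerivAt_rpow_const (p := p - 1) (Or.inl h.ne')).const_mul p
    rwa [show p - 1 - 1 = p - 2 by ring] at h2

theorem contDiffAt_rpow {N : ℕ} (c : Euc N) (a p : ℝ) (x : Euc N) (h : 0 < ‖x - c‖ ^ 2 + a) :
    ContDiffAt ℝ 2 (fun y : Euc N => (‖y - c‖ ^ 2 + a) ^ p) x :=
  (contDiff_normSq_sub_add c a).contDiffAt.rpow_const_of_ne h.ne'

theorem sum_sq_fderiv_rpow {N : ℕ} (c : Euc N) (a p : ℝ) (x : Euc N) (h : 0 < ‖x - c‖ ^ 2 + a) :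
    ∑ i, fderiv ℝ (fun y => (‖y - c‖ ^ 2 + a) ^ p) x (EuclideanSpace.single i 1) ^ 2 =
      4 * ‖x - c‖ ^ 2 * (p * (‖x - c‖ ^ 2 + a) ^ (p - 1)) ^ 2 :=
  sum_sq_fderiv_radial (g := fun t => t ^ p) c a x (Real.hasDerivAt_rpow_const (Or.inl h.ne'))

/-- The regularised fundamental solution is superharmonic, with explicit Laplacian. -/
theorem lap_regularized_fundamental {N : ℕ} (c : Euc N) (a : ℝ) (x : Euc N)
    (h : 0 < ‖x - c‖ ^ 2 + a) :
    lap (fun y => (‖y - c‖ ^ 2 + a) ^ ((2 - N : ℝ) / 2)) x =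
      -(N * (N - 2) * a * (‖x - c‖ ^ 2 + a) ^ (-(N + 2 : ℝ) / 2)) := by
  rw [lap_rpow c a _ x h]
  have h1 : (‖x - c‖ ^ 2 + a) ^ ((2 - N : ℝ) / 2 - 1) =
      (‖x - c‖ ^ 2 + a) * (‖x - c‖ ^ 2 + a) ^ (-(N + 2 : ℝ) / 2) := by
    rw [mul_comm, ← Real.rpow_add_one h.ne']
    congr 1; ring
  have h2 : (2 - N : ℝ) / 2 - 2 = -(N + 2 : ℝ) / 2 := by ring
  rw [h1, h2]
  ring

/-- The smooth convex ramp `t ↦ t * exp (-1 / t)` for `0 < t`, extended by zero. -/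
def ramp (t : ℝ) : ℝ := t * expNegInvGlue t

theorem hasDerivAt_ramp (t : ℝ) : HasDerivAt ramp ((1 + t⁻¹) * expNegInvGlue t) t := by
  have h := expNegInvGlue.hasDerivAt_polynomial_eval_inv_mul 1 t
  simp only [Polynomial.eval_one, one_mul] at h
  have h2 : HasDerivAt ramp _ t := (hasDerivAt_id' t).fun_mul h
  refine h2.congr_deriv ?_
  rcases eq_or_ne t 0 with rfl | ht
  · simp
  · simp
    field_simp

theorem hasDerivAt_deriv_ramp (t : ℝ) :
    HasDerivAt (fun t => (1 + t⁻¹) * expNegInvGlue t) (t⁻¹ ^ 3 * expNegInvGlue t) t := by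
  have h := expNegInvGlue.hasDerivAt_polynomial_eval_inv_mul (1 + Polynomial.X) t
  simp only [Polynomial.eval_add, Polynomial.eval_one, Polynomial.eval_X] at h
  refine h.congr_deriv ?_
  congr 1
  simp
  ring

theorem ramp_nonneg (t : ℝ) : 0 ≤ ramp t := by
  rcases le_or_gt t 0 with h | h
  · simp [ramp, expNegInvGlue.zero_of_nonpos h]
  · exact mul_nonneg h.le (expNegInvGlue.nonneg t)

theorem ramp_of_nonpos {t : ℝ} (h : t ≤ 0) : ramp t = 0 := by
  simp [ramp, expNegInvGlue.zero_of_nonpos h]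

theorem deriv_ramp_nonneg (t : ℝ) : 0 ≤ (1 + t⁻¹) * expNegInvGlue t := by
  rcases le_or_gt t 0 with h | h
  · simp [expNegInvGlue.zero_of_nonpos h]
  · exact mul_nonneg (by positivity) (expNegInvGlue.nonneg t)

theorem deriv_ramp_le_one (t : ℝ) : (1 + t⁻¹) * expNegInvGlue t ≤ 1 := by
  rcases le_or_gt t 0 with h | h
  · simp [expNegInvGlue.zero_of_nonpos h]
  · rw [expNegInvGlue, if_neg h.not_ge, Real.exp_neg, ← div_eq_mul_inv,
      div_le_one (Real.exp_pos _), add_comm]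
    exact Real.add_one_le_exp _

theorem deriv_deriv_ramp_nonneg (t : ℝ) : 0 ≤ t⁻¹ ^ 3 * expNegInvGlue t := by
  rcases le_or_gt t 0 with h | h
  · simp [expNegInvGlue.zero_of_nonpos h]
  · exact mul_nonneg (by positivity) (expNegInvGlue.nonneg t)

theorem le_deriv_deriv_ramp {s t : ℝ} (hs : 0 < s) (hst : s ≤ t) (ht : t ≤ 1) :
    expNegInvGlue s ≤ t⁻¹ ^ 3 * expNegInvGlue t := by
  have h1 : 1 ≤ t⁻¹ ^ 3 := one_le_pow₀ ((one_le_inv₀ (hs.trans_le hst)).2 ht)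
  nlinarith [expNegInvGlue.monotone hst, expNegInvGlue.nonneg t]

theorem contDiff_ramp : ContDiff ℝ 2 ramp :=
  contDiff_id.mul (expNegInvGlue.contDiff (n := 2))

theorem lap_eq_zero_of_eventuallyEq {N : ℕ} {u : Euc N → ℝ} {x : Euc N}
    (h : u =ᶠ[𝓝 x] fun _ => 0) : lap u x = 0 := by
  rw [lap_congr h]
  simp [lap]

/-- Green's identity on the punctured space against a test function vanishing near the origin. -/
theorem green_identity {N : ℕ} {w Ψ : Euc N → ℝ} (hw : ContDiffOn ℝ 2 w {x : Euc N | x ≠ 0})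
    (hΨ : ContDiff ℝ 2 Ψ) (h0 : ∀ᶠ y in 𝓝 (0 : Euc N), Ψ y = 0) (hc : HasCompactSupport Ψ) :
    Integrable (fun y => lap w y * Ψ y - w y * lap Ψ y) ∧
      ∫ y, (lap w y * Ψ y - w y * lap Ψ y) = 0 := by
  have hwat (y : Euc N) (hy : y ≠ 0) : ContDiffAt ℝ 2 w y :=
    hw.contDiffAt (isOpen_ne.mem_nhds hy)
  set P : Fin N → Euc N → ℝ := fun i y =>
    fderiv ℝ w y (EuclideanSpace.single i 1) * Ψ y -
      w y * fderiv ℝ Ψ y (EuclideanSpace.single i 1) with hP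
  have hΨ0 : ∀ᶠ y in 𝓝 (0 : Euc N), fderiv ℝ Ψ y = 0 := by
    have : Ψ =ᶠ[𝓝 0] fun _ => 0 := h0
    filter_upwards [this.fderiv (𝕜 := ℝ)] with y hy
    simp [hy]
  have hPc (i : Fin N) : ContDiff ℝ 1 (P i) := by
    rw [contDiff_iff_contDiffAt]
    intro y
    by_cases hy : y = 0
    · subst hy
      refine (contDiffAt_const (c := (0 : ℝ))).congr_of_eventuallyEq ?_
      filter_upwards [h0, hΨ0] with y h1 h2
      simp [hP, h1, h2]
    · have h1 := hwat y hy
      exact ((contDiffAt_fderiv_apply h1 _).mul (hΨ.contDiffAt.of_le (by norm_num))).sub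
        ((h1.of_le (by norm_num)).mul (contDiffAt_fderiv_apply hΨ.contDiffAt _))
  have hPs (i : Fin N) : HasCompactSupport (P i) := by
    refine HasCompactSupport.intro hc fun y hy => ?_
    have h1 : Ψ y = 0 := image_eq_zero_of_notMem_tsupport hy
    have h2 : fderiv ℝ Ψ y = 0 := by
      by_contra h
      exact hy (support_fderiv_subset ℝ h)
    simp [hP, h1, h2]
  have hQc (i : Fin N) : Continuous (fun y => fderiv ℝ (P i) y (EuclideanSpace.single i 1)) :=
    ((hPc i).continuous_fderiv (by simp)).clm_apply continuous_const
  have hQi (i : Fin N) : Integrable (fun y => fderiv ℝ (P i) y (EuclideanSpace.single i 1)) :=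
    (hQc i).integrable_of_hasCompactSupport ((hPs i).fderiv_apply ℝ _)
  have hQ0 (i : Fin N) : ∫ y, fderiv ℝ (P i) y (EuclideanSpace.single i 1) = 0 := by
    have := integral_mul_fderiv_eq_neg_fderiv_mul_of_integrable (μ := volume)
      (f := fun _ : Euc N => (1 : ℝ)) (g := P i) (v := EuclideanSpace.single i 1)
      (by simp) (by simpa using hQi i)
      (by simpa using (hPc i).continuous.integrable_of_hasCompactSupport (hPs i))
      (fun _ _ => differentiableAt_const _) (fun y _ => (hPc i).differentiable (by simp) y)
    simpa using this
  have key : (fun y => lap w y * Ψ y - w y * lap Ψ y) =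
      fun y => ∑ i, fderiv ℝ (P i) y (EuclideanSpace.single i 1) := by
    ext y
    by_cases hy : y = 0
    · subst hy
      have h1 (i : Fin N) : fderiv ℝ (P i) 0 = 0 := by
        have : P i =ᶠ[𝓝 0] fun _ => 0 := by
          filter_upwards [h0, hΨ0] with y h1 h2
          simp [hP, h1, h2]
        rw [this.fderiv_eq]; simp
      simp [h1, h0.self_of_nhds, lap_eq_zero_of_eventuallyEq h0]
    · have h1 := hwat y hy
      unfold lap
      rw [Finset.sum_mul, Finset.mul_sum, ← Finset.sum_sub_distrib]
      refine Finset.sum_congr rfl fun i _ => ?_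
      have a1 := ((contDiffAt_fderiv_apply h1 (EuclideanSpace.single i 1)).differentiableAt
        (by simp)).hasFDerivAt
      have a2 := (hΨ.differentiable (by simp) y).hasFDerivAt
      have a3 := (h1.differentiableAt (by simp)).hasFDerivAt
      have a4 := ((contDiffAt_fderiv_apply (hΨ.contDiffAt (x := y))
        (EuclideanSpace.single i 1)).differentiableAt (by simp)).hasFDerivAt
      rw [hP, ((a1.fun_mul a2).fun_sub (a3.fun_mul a4)).fderiv]
      simp
      ring
  rw [key]
  refine ⟨integrable_finsetSum _ fun i _ => hQi i, ?_⟩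
  rw [integral_finsetSum _ fun i _ => hQi i]
  simp [hQ0]

/-- The closed annulus `a ≤ ‖y‖ ≤ b`. -/
def annulus (N : ℕ) (a b : ℝ) : Set (Euc N) := closedBall 0 b \ ball 0 a

theorem mem_annulus {N : ℕ} {a b : ℝ} {y : Euc N} : y ∈ annulus N a b ↔ a ≤ ‖y‖ ∧ ‖y‖ ≤ b := by
  simp [annulus, and_comm]

theorem isCompact_annulus (N : ℕ) (a b : ℝ) : IsCompact (annulus N a b) :=
  (isCompact_closedBall _ _).diff isOpen_ball

theorem annulus_subset_ne_zero {N : ℕ} {a b : ℝ} (ha : 0 < a) :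
    annulus N a b ⊆ {x : Euc N | x ≠ 0} := by
  rintro y hy rfl
  have := (mem_annulus.1 hy).1
  simp at this
  linarith

/-- The shifted difference of two regularised fundamental solutions, composed with `ramp`. -/
theorem lap_ramp_sub {N : ℕ} (x : Euc N) {a b : ℝ} (ha : 0 < a) (hb : 0 < b) (κ s : ℝ) (y : Euc N) :
    lap (fun y => ramp ((‖y - x‖ ^ 2 + a) ^ ((2 - N : ℝ) / 2) -
        κ * (‖y - 0‖ ^ 2 + b) ^ ((2 - N : ℝ) / 2) - s)) y =
      ((‖y - x‖ ^ 2 + a) ^ ((2 - N : ℝ) / 2) -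
        κ * (‖y - 0‖ ^ 2 + b) ^ ((2 - N : ℝ) / 2) - s)⁻¹ ^ 3 *
        expNegInvGlue ((‖y - x‖ ^ 2 + a) ^ ((2 - N : ℝ) / 2) -
          κ * (‖y - 0‖ ^ 2 + b) ^ ((2 - N : ℝ) / 2) - s) *
        ∑ i, (fderiv ℝ (fun y => (‖y - x‖ ^ 2 + a) ^ ((2 - N : ℝ) / 2)) y
            (EuclideanSpace.single i 1) -
          κ * fderiv ℝ (fun y => (‖y - 0‖ ^ 2 + b) ^ ((2 - N : ℝ) / 2)) y
            (EuclideanSpace.single i 1)) ^ 2 +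
      (1 + ((‖y - x‖ ^ 2 + a) ^ ((2 - N : ℝ) / 2) -
        κ * (‖y - 0‖ ^ 2 + b) ^ ((2 - N : ℝ) / 2) - s)⁻¹) *
        expNegInvGlue ((‖y - x‖ ^ 2 + a) ^ ((2 - N : ℝ) / 2) -
          κ * (‖y - 0‖ ^ 2 + b) ^ ((2 - N : ℝ) / 2) - s) *
        (κ * (N * (N - 2) * b * (‖y - 0‖ ^ 2 + b) ^ (-(N + 2 : ℝ) / 2)) -
          N * (N - 2) * a * (‖y - x‖ ^ 2 + a) ^ (-(N + 2 : ℝ) / 2)) := by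
  have hX : 0 < ‖y - x‖ ^ 2 + a := by positivity
  have hS : 0 < ‖y - 0‖ ^ 2 + b := by positivity
  have h1 := contDiffAt_rpow x a ((2 - N : ℝ) / 2) y hX
  have h2 := contDiffAt_rpow 0 b ((2 - N : ℝ) / 2) y hS
  rw [lap_comp (g := fun t => ramp (t - s)) (g₁ := fun t => (1 + (t - s)⁻¹) * expNegInvGlue (t - s))
    (h1.sub (contDiffAt_const.mul h2))
    (Eventually.of_forall fun t => (hasDerivAt_ramp (t - s)).comp_sub_const t s)
    ((hasDerivAt_deriv_ramp _).comp_sub_const _ s)]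
  have h3 := lap_sub_const_mul h1 h2 κ
  rw [lap_regularized_fundamental x a y hX, lap_regularized_fundamental 0 b y hS] at h3
  have h4 (i : Fin N) : fderiv ℝ (fun y => (‖y - x‖ ^ 2 + a) ^ ((2 - N : ℝ) / 2) -
      κ * (‖y - 0‖ ^ 2 + b) ^ ((2 - N : ℝ) / 2)) y (EuclideanSpace.single i 1) =
      fderiv ℝ (fun y => (‖y - x‖ ^ 2 + a) ^ ((2 - N : ℝ) / 2)) y (EuclideanSpace.single i 1) -
        κ * fderiv ℝ (fun y => (‖y - 0‖ ^ 2 + b) ^ ((2 - N : ℝ) / 2)) y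
          (EuclideanSpace.single i 1) := by
    have d1 := h1.differentiableAt (by simp)
    have d2 := h2.differentiableAt (by simp)
    rw [fderiv_fun_sub d1 (d2.const_mul κ), fderiv_const_mul d2]
    simp
  change _ * ∑ i, fderiv ℝ (fun y => (‖y - x‖ ^ 2 + a) ^ ((2 - N : ℝ) / 2) -
      κ * (‖y - 0‖ ^ 2 + b) ^ ((2 - N : ℝ) / 2)) y (EuclideanSpace.single i 1) ^ 2 +
      _ * lap (fun y => (‖y - x‖ ^ 2 + a) ^ ((2 - N : ℝ) / 2) -
      κ * (‖y - 0‖ ^ 2 + b) ^ ((2 - N : ℝ) / 2)) y = _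
  simp_rw [h4, h3]
  ring

theorem exists_rpow_eq {p c : ℝ} (hp : p ≠ 0) (hc : 0 < c) : ∃ q, 0 < q ∧ q ^ p = c :=
  ⟨c ^ p⁻¹, Real.rpow_pos_of_pos hc _, Real.rpow_inv_rpow hc.le hp⟩

theorem half_sum_sq_sub_le_sum_sq_sub {ι : Type*} [Fintype ι] (f g : ι → ℝ) (κ : ℝ) :
    1 / 2 * ∑ i, f i ^ 2 - κ ^ 2 * ∑ i, g i ^ 2 ≤ ∑ i, (f i - κ * g i) ^ 2 := by
  rw [Finset.mul_sum, Finset.mul_sum, ← Finset.sum_sub_distrib]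
  refine Finset.sum_le_sum fun i _ => ?_
  nlinarith [sq_nonneg (f i - 2 * (κ * g i))]

set_option maxHeartbeats 800000 in
/-- Test functions, uniform in the regularisation parameter `a`, which are strictly subharmonic on
an annulus and whose Laplacian is negative only through an approximate identity at `x`. -/
theorem exists_test_function (N : ℕ) (hN : 3 ≤ N) :
    ∃ c > 0, ∃ η > 0, η ≤ 1 / 2 ∧ ∃ R ≥ 3, ∀ x : Euc N, ‖x‖ = 1 → ∀ a, 0 < a → a ≤ 1 →
      ∃ Ψ : Euc N → ℝ, ContDiff ℝ 2 Ψ ∧ (∀ y, 0 ≤ Ψ y) ∧ (∀ y, ‖y‖ ≤ η ∨ R ≤ ‖y‖ → Ψ y = 0) ∧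
        (∀ y, -(N * (N - 2) * a * (‖y - x‖ ^ 2 + a) ^ (-(N + 2 : ℝ) / 2)) ≤ lap Ψ y) ∧
        ∀ y ∈ annulus N 2 3,
          c - N * (N - 2) * a * (‖y - x‖ ^ 2 + a) ^ (-(N + 2 : ℝ) / 2) ≤ lap Ψ y := by
  have hN' : (3 : ℝ) ≤ N := by exact_mod_cast hN
  set p : ℝ := (2 - N : ℝ) / 2 with hp
  have hp0 : p < 0 := by rw [hp]; linarith
  set t₀ : ℝ := 17 ^ p with ht₀
  set σ : ℝ := 17 ^ (p - 1) with hσ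
  have ht₀pos : 0 < t₀ := by positivity
  have hσpos : 0 < σ := by positivity
  have hσt : 17 * σ = t₀ := by
    rw [ht₀, hσ, Real.rpow_sub_one (by norm_num)]; ring
  set κ : ℝ := σ / 6 with hκ
  have hκpos : 0 < κ := by positivity
  obtain ⟨q, hq, hqp⟩ := exists_rpow_eq hp0.ne (c := (1 / 4) ^ p / κ) (by positivity)
  obtain ⟨S, hS, hSp⟩ := exists_rpow_eq hp0.ne (c := t₀ / 2) (by positivity)
  set η : ℝ := min (1 / 2) √(q / 2) with hη
  have hηpos : 0 < η := lt_min (by norm_num) (Real.sqrt_pos.2 (by positivity))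
  have hη1 : η ≤ 1 / 2 := min_le_left _ _
  have hη2 : η ^ 2 ≤ q / 2 := by
    rw [← Real.sq_sqrt (show 0 ≤ q / 2 by positivity)]
    exact pow_le_pow_left₀ hηpos.le (min_le_right _ _) 2
  refine ⟨expNegInvGlue (t₀ / 4) * (p ^ 2 * σ ^ 2), ?_, η, hηpos, hη1, max 3 (1 + √S),
    le_max_left _ _, fun x hx a ha ha1 => ?_⟩
  · have := expNegInvGlue.pos_of_pos (x := t₀ / 4) (by positivity)
    have := hp0.ne
    positivity
  have hb : 0 < η ^ 2 := by positivity
  have hX (y : Euc N) : 0 < ‖y - x‖ ^ 2 + a := by positivity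
  have hZ (y : Euc N) : 0 < ‖y - 0‖ ^ 2 + η ^ 2 := by positivity
  have htri1 (y : Euc N) : ‖y‖ - 1 ≤ ‖y - x‖ := hx ▸ norm_sub_norm_le y x
  have htri2 (y : Euc N) : 1 - ‖y‖ ≤ ‖y - x‖ := by
    rw [norm_sub_rev]; exact hx ▸ norm_sub_norm_le x y
  have htri3 (y : Euc N) : ‖y - x‖ ≤ ‖y‖ + 1 := hx ▸ norm_sub_le y x
  have hlow (G : ℝ) (y : Euc N) : -(N * (N - 2) * a * (‖y - x‖ ^ 2 + a) ^ (-(N + 2 : ℝ) / 2)) ≤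
      (1 + G⁻¹) * expNegInvGlue G *
        (κ * (N * (N - 2) * η ^ 2 * (‖y - 0‖ ^ 2 + η ^ 2) ^ (-(N + 2 : ℝ) / 2)) -
          N * (N - 2) * a * (‖y - x‖ ^ 2 + a) ^ (-(N + 2 : ℝ) / 2)) := by
    have h2 : (0 : ℝ) ≤ N - 2 := by linarith
    have h3 : 0 ≤ κ * (N * (N - 2) * η ^ 2 * (‖y - 0‖ ^ 2 + η ^ 2) ^ (-(N + 2 : ℝ) / 2)) := by
      positivity
    have h4 : 0 ≤ N * (N - 2) * a * (‖y - x‖ ^ 2 + a) ^ (-(N + 2 : ℝ) / 2) := by positivity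
    nlinarith [mul_nonneg (deriv_ramp_nonneg G) h3,
      mul_nonneg (sub_nonneg.2 (deriv_ramp_le_one G)) h4]
  refine ⟨fun y => ramp ((‖y - x‖ ^ 2 + a) ^ p - κ * (‖y - 0‖ ^ 2 + η ^ 2) ^ p - t₀ / 2),
    ?_, fun y => ramp_nonneg _, ?_, ?_, ?_⟩
  · rw [contDiff_iff_contDiffAt]
    intro y
    exact contDiff_ramp.contDiffAt.comp y (((contDiffAt_rpow x a p y (hX y)).sub
      (contDiffAt_const.mul (contDiffAt_rpow 0 (η ^ 2) p y (hZ y)))).sub contDiffAt_const)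
  · rintro y (hy | hy)
    · refine ramp_of_nonpos ?_
      have h1 : (‖y - x‖ ^ 2 + a) ^ p ≤ (1 / 4) ^ p :=
        Real.rpow_le_rpow_of_nonpos (by norm_num) (by nlinarith [htri2 y]) hp0.le
      have h2 : q ^ p ≤ (‖y - 0‖ ^ 2 + η ^ 2) ^ p := by
        refine Real.rpow_le_rpow_of_nonpos (hZ y) ?_ hp0.le
        rw [sub_zero]
        nlinarith [norm_nonneg y]
      rw [hqp, div_le_iff₀' hκpos] at h2
      linarith
    · refine ramp_of_nonpos ?_
      have h0 := htri1 y
      have h0' := (le_max_right _ _).trans hy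
      have h1 : (‖y - x‖ ^ 2 + a) ^ p ≤ S ^ p := by
        refine Real.rpow_le_rpow_of_nonpos hS ?_ hp0.le
        nlinarith [Real.sq_sqrt hS.le, Real.sqrt_nonneg S]
      have h2 : 0 ≤ κ * (‖y - 0‖ ^ 2 + η ^ 2) ^ p := by positivity
      linarith
  · intro y
    rw [lap_ramp_sub x ha hb κ (t₀ / 2) y, ← hp]
    set G := (‖y - x‖ ^ 2 + a) ^ p - κ * (‖y - 0‖ ^ 2 + η ^ 2) ^ p - t₀ / 2
    refine (hlow G y).trans (le_add_of_nonneg_left ?_)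
    exact mul_nonneg (deriv_deriv_ramp_nonneg G) (Finset.sum_nonneg fun i _ => sq_nonneg _)
  · intro y hy
    obtain ⟨hy2, hy3⟩ := mem_annulus.1 hy
    rw [lap_ramp_sub x ha hb κ (t₀ / 2) y, ← hp]
    set G := (‖y - x‖ ^ 2 + a) ^ p - κ * (‖y - 0‖ ^ 2 + η ^ 2) ^ p - t₀ / 2 with hG
    rw [sub_eq_add_neg]
    refine add_le_add ?_ (hlow G y)
    have hy1 : 1 ≤ ‖y - x‖ := by linarith [htri1 y]
    have hy4 : ‖y - x‖ ≤ 4 := by linarith [htri3 y]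
    have hX1 : 1 ≤ ‖y - x‖ ^ 2 + a := by nlinarith
    have hX2 : ‖y - x‖ ^ 2 + a ≤ 17 := by nlinarith
    have hZ1 : 1 ≤ ‖y - 0‖ ^ 2 + η ^ 2 := by rw [sub_zero]; nlinarith
    have hG1 : t₀ / 4 ≤ G := by
      have h1 : t₀ ≤ (‖y - x‖ ^ 2 + a) ^ p := Real.rpow_le_rpow_of_nonpos (hX y) hX2 hp0.le
      have h2 : (‖y - 0‖ ^ 2 + η ^ 2) ^ p ≤ 1 := Real.rpow_le_one_of_one_le_of_nonpos hZ1 hp0.le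
      nlinarith
    have hG2 : G ≤ 1 := by
      have h1 : (‖y - x‖ ^ 2 + a) ^ p ≤ 1 := Real.rpow_le_one_of_one_le_of_nonpos hX1 hp0.le
      have h2 : 0 ≤ κ * (‖y - 0‖ ^ 2 + η ^ 2) ^ p := by positivity
      linarith
    refine mul_le_mul (le_deriv_deriv_ramp (by positivity) hG1 hG2) ?_ (by positivity)
      (deriv_deriv_ramp_nonneg G)
    refine le_trans ?_ (half_sum_sq_sub_le_sum_sq_sub _ _ κ)
    rw [sum_sq_fderiv_rpow x a p y (hX y), sum_sq_fderiv_rpow 0 (η ^ 2) p y (hZ y), mul_pow,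
      mul_pow]
    have h1 : σ ^ 2 ≤ ((‖y - x‖ ^ 2 + a) ^ (p - 1)) ^ 2 :=
      pow_le_pow_left₀ hσpos.le (Real.rpow_le_rpow_of_nonpos (hX y) hX2 (by linarith)) 2
    have h2 : ((‖y - 0‖ ^ 2 + η ^ 2) ^ (p - 1)) ^ 2 ≤ 1 :=
      pow_le_one₀ (by positivity) (Real.rpow_le_one_of_one_le_of_nonpos hZ1 (by linarith))
    have h3 : 4 * (p ^ 2 * σ ^ 2) ≤
        4 * ‖y - x‖ ^ 2 * (p ^ 2 * ((‖y - x‖ ^ 2 + a) ^ (p - 1)) ^ 2) := by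
      refine mul_le_mul ?_ (by gcongr) (by positivity) (by positivity)
      nlinarith
    have h4 : 4 * ‖y - 0‖ ^ 2 * (p ^ 2 * ((‖y - 0‖ ^ 2 + η ^ 2) ^ (p - 1)) ^ 2) ≤
        36 * (p ^ 2 * 1) := by
      refine mul_le_mul ?_ (by gcongr) (by positivity) (by positivity)
      rw [sub_zero]
      nlinarith
    have h5 : κ ^ 2 * (36 * (p ^ 2 * 1)) = p ^ 2 * σ ^ 2 := by rw [hκ]; ring
    have h6 := mul_le_mul_of_nonneg_left h4 (sq_nonneg κ)
    linarith

theorem continuousOn_annulus {N : ℕ} {w : Euc N → ℝ} (hw : ContDiffOn ℝ 2 w {x : Euc N | x ≠ 0})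
    {a b : ℝ} (ha : 0 < a) : ContinuousOn w (annulus N a b) :=
  hw.continuousOn.mono (annulus_subset_ne_zero ha)

theorem measurableSet_annulus (N : ℕ) (a b : ℝ) : MeasurableSet (annulus N a b) :=
  (isCompact_annulus N a b).measurableSet

/-- The kernel `a / (‖y - x‖² + a) ^ ((N + 2) / 2)`, up to a constant, controls the mass of a
positive superharmonic function on an annulus. -/
theorem exists_annulus_integral_le_kernel (N : ℕ) (hN : 3 ≤ N) :
    ∃ C > 0, ∃ η > 0, η ≤ 1 / 2 ∧ ∃ R ≥ 3, ∀ w : Euc N → ℝ,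
      ContDiffOn ℝ 2 w {x : Euc N | x ≠ 0} → (∀ y, y ≠ 0 → 0 ≤ w y) →
      (∀ y, y ≠ 0 → lap w y ≤ 0) → ∀ x : Euc N, ‖x‖ = 1 → ∀ a, 0 < a → a ≤ 1 →
      ∫ y in annulus N 2 3, w y ≤
        C * ∫ y in annulus N η R, a * (‖y - x‖ ^ 2 + a) ^ (-(N + 2 : ℝ) / 2) * w y := by
  obtain ⟨c, hc, η, hη, hη1, R, hR, H⟩ := exists_test_function N hN
  have hN' : (3 : ℝ) ≤ N := by exact_mod_cast hN
  refine ⟨N * (N - 2) / c, ?_, η, hη, hη1, R, hR, fun w hw hw0 hlap x hx a ha ha1 => ?_⟩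
  · have : (0 : ℝ) < N - 2 := by linarith
    positivity
  obtain ⟨Ψ, hΨ, hΨ0, hΨz, hlow, hlowA⟩ := H x hx a ha ha1
  set D : Euc N → ℝ := fun y => a * (‖y - x‖ ^ 2 + a) ^ (-(N + 2 : ℝ) / 2) with hD
  have hDc : Continuous D := by
    refine continuous_const.mul (Continuous.rpow_const (by fun_prop) fun y => Or.inl ?_)
    positivity
  have hD0 (y : Euc N) : 0 ≤ D y := by simp only [hD]; positivity
  have hsub : annulus N 2 3 ⊆ annulus N η R := fun y hy => by
    rw [mem_annulus] at hy ⊢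
    constructor <;> linarith [hy.1, hy.2]
  have hcs : HasCompactSupport Ψ := by
    refine HasCompactSupport.intro (isCompact_closedBall (0 : Euc N) R) fun y hy => hΨz y ?_
    rw [mem_closedBall_zero_iff, not_le] at hy
    exact Or.inr hy.le
  have h0 : ∀ᶠ y in 𝓝 (0 : Euc N), Ψ y = 0 := by
    filter_upwards [closedBall_mem_nhds (0 : Euc N) hη] with y hy
    exact hΨz y (Or.inl (mem_closedBall_zero_iff.1 hy))
  obtain ⟨hint, hgreen⟩ := green_identity hw hΨ h0 hcs
  have hA : IntegrableOn w (annulus N 2 3) :=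
    (continuousOn_annulus hw two_pos).integrableOn_compact (isCompact_annulus N 2 3)
  have hB : IntegrableOn (fun y => D y * w y) (annulus N η R) :=
    (hDc.continuousOn.mul (continuousOn_annulus hw hη)).integrableOn_compact
      (isCompact_annulus N η R)
  have hA' := hA.integrable_indicator (measurableSet_annulus N 2 3)
  have hB' := hB.integrable_indicator (measurableSet_annulus N η R)
  have key (y : Euc N) : lap w y * Ψ y - w y * lap Ψ y ≤
      N * (N - 2) * (annulus N η R).indicator (fun y => D y * w y) y -
        c * (annulus N 2 3).indicator w y := by
    by_cases hyB : y ∈ annulus N η R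
    · have hy0 : y ≠ 0 := annulus_subset_ne_zero hη hyB
      have h1 : lap w y * Ψ y ≤ 0 := mul_nonpos_of_nonpos_of_nonneg (hlap y hy0) (hΨ0 y)
      rw [Set.indicator_of_mem hyB]
      by_cases hyA : y ∈ annulus N 2 3
      · rw [Set.indicator_of_mem hyA]
        have h2 := mul_le_mul_of_nonneg_left (hlowA y hyA) (hw0 y hy0)
        simp only [hD]
        linarith
      · rw [Set.indicator_of_notMem hyA]
        have h2 := mul_le_mul_of_nonneg_left (hlow y) (hw0 y hy0)
        simp only [hD]
        linarith
    · have hev : Ψ =ᶠ[𝓝 y] fun _ => 0 := by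
        have ho : IsOpen (annulus N η R)ᶜ := (isCompact_annulus N η R).isClosed.isOpen_compl
        filter_upwards [ho.mem_nhds hyB] with z hz
        refine hΨz z ?_
        by_contra! h
        exact hz (mem_annulus.2 ⟨h.1.le, h.2.le⟩)
      rw [Set.indicator_of_notMem hyB, Set.indicator_of_notMem fun h => hyB (hsub h),
        lap_eq_zero_of_eventuallyEq hev, hev.self_of_nhds]
      simp
  have hle := integral_mono hint ((hB'.const_mul (N * (N - 2) : ℝ)).sub (hA'.const_mul c)) key
  rw [hgreen] at hle
  simp only [Pi.sub_apply] at hle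
  rw [integral_sub (hB'.const_mul _) (hA'.const_mul c),
    integral_const_mul, integral_const_mul, integral_indicator (measurableSet_annulus N 2 3),
    integral_indicator (measurableSet_annulus N η R)] at hle
  rw [div_mul_eq_mul_div, le_div_iff₀' hc]
  linarith

theorem kernel_eq_rescaled {N : ℕ} (x y : Euc N) {c : ℝ} (hc : 0 < c) :
    c⁻¹ ^ 2 * (‖y - x‖ ^ 2 + c⁻¹ ^ 2) ^ (-(N + 2 : ℝ) / 2) =
      c ^ N * (1 + ‖c • (x - y)‖ ^ 2) ^ (-(N + 2 : ℝ) / 2) := by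
  have h1 : ‖y - x‖ ^ 2 + c⁻¹ ^ 2 = c⁻¹ ^ 2 * (1 + ‖c • (x - y)‖ ^ 2) := by
    rw [norm_smul, norm_sub_rev, Real.norm_of_nonneg hc.le]
    field_simp
    ring
  have h2 : (c⁻¹ ^ 2) ^ (-(N + 2 : ℝ) / 2) = c ^ (N + 2) := by
    rw [← Real.rpow_natCast, ← Real.rpow_mul (by positivity), Real.inv_rpow hc.le,
      ← Real.rpow_neg hc.le, ← Real.rpow_natCast c]
    congr 1
    push_cast
    ring
  rw [h1, Real.mul_rpow (by positivity) (by positivity), h2, pow_add]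
  field_simp

theorem tendsto_norm_pow_mul_rpow_cobounded (N : ℕ) :
    Tendsto (fun z : Euc N => ‖z‖ ^ N * (1 + ‖z‖ ^ 2) ^ (-(N + 2 : ℝ) / 2))
      (Bornology.cobounded (Euc N)) (𝓝 0) := by
  have h1 : Tendsto (fun z : Euc N => (‖z‖ ^ 2)⁻¹) (Bornology.cobounded (Euc N)) (𝓝 0) :=
    ((tendsto_pow_atTop two_ne_zero).comp
      (tendsto_norm_cobounded_atTop (E := Euc N))).inv_tendsto_atTop
  refine squeeze_zero' (Eventually.of_forall fun z => by positivity) ?_ h1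
  filter_upwards [tendsto_norm_cobounded_atTop.eventually_gt_atTop 0] with z hz
  have h2 : (1 + ‖z‖ ^ 2) ^ (-(N + 2 : ℝ) / 2) ≤ (‖z‖ ^ 2) ^ (-(N + 2 : ℝ) / 2) :=
    Real.rpow_le_rpow_of_nonpos (by positivity) (by linarith)
      (by have : (0 : ℝ) ≤ N := N.cast_nonneg
          linarith)
  have h3 : (‖z‖ ^ 2) ^ (-(N + 2 : ℝ) / 2) = (‖z‖ ^ (N + 2))⁻¹ := by
    rw [← Real.rpow_natCast, ← Real.rpow_mul hz.le, ← Real.rpow_natCast, ← Real.rpow_neg hz.le]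
    congr 1
    push_cast
    ring
  refine (mul_le_mul_of_nonneg_left (h2.trans_eq h3) (by positivity)).trans_eq ?_
  rw [pow_add]
  field_simp

/-- The kernels `c⁻² / (‖y - x‖² + c⁻²) ^ ((N + 2) / 2)` form an approximate identity, up to a
constant. -/
theorem exists_tendsto_integral_kernel (N : ℕ) :
    ∃ M > 0, ∀ (g : Euc N → ℝ) (x : Euc N), Integrable g → ContinuousAt g x →
      Tendsto (fun c : ℝ => ∫ y, c⁻¹ ^ 2 * (‖y - x‖ ^ 2 + c⁻¹ ^ 2) ^ (-(N + 2 : ℝ) / 2) * g y) atTop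
        (𝓝 (M * g x)) := by
  set φ : Euc N → ℝ := fun z => (1 + ‖z‖ ^ 2) ^ (-(N + 2 : ℝ) / 2) with hφ
  have hφpos (z : Euc N) : 0 < φ z := by simp only [hφ]; positivity
  have hφint : Integrable φ := integrable_rpow_neg_one_add_norm_sq (by simp)
  set M := ∫ z, φ z with hM
  have hMpos : 0 < M := by
    rw [hM, integral_pos_iff_support_of_nonneg (fun z => (hφpos z).le) hφint]
    have : Function.support φ = Set.univ := Set.eq_univ_of_forall fun z => (hφpos z).ne'
    rw [this]
    exact Measure.measure_univ_pos.2 (NeZero.ne _)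
  have hdecay : Tendsto (fun z : Euc N => ‖z‖ ^ Module.finrank ℝ (Euc N) * (M⁻¹ * φ z))
      (Bornology.cobounded (Euc N)) (𝓝 0) := by
    have h := (tendsto_norm_pow_mul_rpow_cobounded N).const_mul M⁻¹
    rw [mul_zero] at h
    refine h.congr fun z => ?_
    rw [finrank_euclideanSpace_fin, mul_left_comm]
  refine ⟨M, hMpos, fun g x hg hx => ?_⟩
  have hlim := (tendsto_integral_comp_smul_smul_of_integrable' (μ := volume)
    (φ := fun z => M⁻¹ * φ z) (fun z => mul_nonneg (inv_nonneg.2 hMpos.le) (hφpos z).le)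
    (by rw [integral_const_mul]; exact inv_mul_cancel₀ hMpos.ne') hdecay hg hx).const_mul M
  refine hlim.congr' ?_
  filter_upwards [eventually_gt_atTop 0] with c hc
  rw [← integral_const_mul]
  refine integral_congr_ae (Eventually.of_forall fun y => ?_)
  simp only [finrank_euclideanSpace_fin, smul_eq_mul]
  rw [kernel_eq_rescaled x y hc]
  simp only [hφ]
  field_simp

/-- Weak Harnack inequality at unit scale for nonnegative superharmonic functions on the punctured
space. -/
theorem exists_annulus_integral_le_of_norm_eq_one (N : ℕ) (hN : 3 ≤ N) :
    ∃ C > 0, ∀ w : Euc N → ℝ, ContDiffOn ℝ 2 w {x : Euc N | x ≠ 0} → (∀ y, y ≠ 0 → 0 ≤ w y) →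
      (∀ y, y ≠ 0 → lap w y ≤ 0) → ∀ x : Euc N, ‖x‖ = 1 →
      ∫ y in annulus N 2 3, w y ≤ C * w x := by
  obtain ⟨C, hC, η, hη, hη1, R, hR, H⟩ := exists_annulus_integral_le_kernel N hN
  obtain ⟨M, hM, HM⟩ := exists_tendsto_integral_kernel N
  refine ⟨C * M, mul_pos hC hM, fun w hw hw0 hlap x hx => ?_⟩
  have hxB : annulus N η R ∈ 𝓝 x := by
    have h0 : Tendsto (fun y : Euc N => ‖y‖) (𝓝 x) (𝓝 1) := hx ▸ continuous_norm.tendsto x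
    filter_upwards [h0.eventually (lt_mem_nhds (show η < 1 by linarith)),
      h0.eventually (gt_mem_nhds (show 1 < R by linarith))] with y h1 h2
    exact mem_annulus.2 ⟨le_of_lt h1, le_of_lt h2⟩
  have hx0 : x ≠ 0 := by rintro rfl; simp at hx
  have hgint : Integrable ((annulus N η R).indicator w) :=
    ((continuousOn_annulus hw hη).integrableOn_compact
      (isCompact_annulus N η R)).integrable_indicator (measurableSet_annulus N η R)
  have hgx : (annulus N η R).indicator w =ᶠ[𝓝 x] w := by
    filter_upwards [hxB] with y hy
    exact Set.indicator_of_mem hy w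
  have hlim := HM _ x hgint
    ((hw.contDiffAt (isOpen_ne.mem_nhds hx0)).continuousAt.congr hgx.symm)
  rw [hgx.self_of_nhds] at hlim
  rw [mul_assoc]
  refine ge_of_tendsto (hlim.const_mul C) ?_
  filter_upwards [eventually_ge_atTop 1] with c hc
  refine (H w hw hw0 hlap x hx (c⁻¹ ^ 2) (by positivity)
    (pow_le_one₀ (by positivity) (inv_le_one_of_one_le₀ hc))).trans_eq ?_
  rw [← integral_indicator (measurableSet_annulus N η R)]
  congr 2
  ext y
  by_cases hy : y ∈ annulus N η R <;> simp [hy]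

theorem lap_comp_smul {N : ℕ} (w : Euc N → ℝ) (r : ℝ) (y : Euc N) :
    lap (fun y => w (r • y)) y = r ^ 2 * lap w (r • y) := by
  unfold lap
  rw [Finset.mul_sum]
  refine Finset.sum_congr rfl fun i _ => ?_
  simp_rw [fderiv_comp_smul, smul_apply]
  have h := fderiv_comp_smul (f := fun z => r * fderiv ℝ w z (EuclideanSpace.single i 1)) (x := y) r
  have h2 : fderiv ℝ (fun z => r * fderiv ℝ w z (EuclideanSpace.single i 1)) = _ :=
    fderiv_const_smul_field r
  rw [h2] at h
  simp only [smul_eq_mul]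
  rw [h]
  simp
  ring

open scoped Pointwise in
theorem smul_annulus {N : ℕ} {r : ℝ} (hr : 0 < r) (a b : ℝ) :
    r • annulus N a b = annulus N (r * a) (r * b) := by
  ext y
  rw [Set.mem_smul_set_iff_inv_smul_mem₀ hr.ne', mem_annulus, mem_annulus, norm_smul, norm_inv,
    Real.norm_of_nonneg hr.le, le_inv_mul_iff₀ hr, inv_mul_le_iff₀ hr]

/-- Weak Harnack inequality for nonnegative superharmonic functions on the punctured space. -/
theorem exists_annulus_integral_le (N : ℕ) (hN : 3 ≤ N) :
    ∃ C > 0, ∀ w : Euc N → ℝ, ContDiffOn ℝ 2 w {x : Euc N | x ≠ 0} → (∀ y, y ≠ 0 → 0 ≤ w y) →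
      (∀ y, y ≠ 0 → lap w y ≤ 0) → ∀ x : Euc N, x ≠ 0 →
      ∫ y in annulus N (2 * ‖x‖) (3 * ‖x‖), w y ≤ C * ‖x‖ ^ N * w x := by
  obtain ⟨C, hC, H⟩ := exists_annulus_integral_le_of_norm_eq_one N hN
  refine ⟨C, hC, fun w hw hw0 hlap x hx => ?_⟩
  have hr : 0 < ‖x‖ := norm_pos_iff.2 hx
  have h := H (fun y => w (‖x‖ • y))
    (hw.comp (contDiff_const_smul ‖x‖).contDiffOn fun y hy => smul_ne_zero hr.ne' hy)
    (fun y hy => hw0 _ (smul_ne_zero hr.ne' hy))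
    (fun y hy => by
      rw [lap_comp_smul]
      exact mul_nonpos_of_nonneg_of_nonpos (sq_nonneg _) (hlap _ (smul_ne_zero hr.ne' hy)))
    (‖x‖⁻¹ • x) (by rw [norm_smul, norm_inv, norm_norm, inv_mul_cancel₀ hr.ne'])
  rw [Measure.setIntegral_comp_smul_of_pos volume w _ hr, smul_annulus hr,
    smul_inv_smul₀ hr.ne', finrank_euclideanSpace_fin, smul_eq_mul,
    inv_mul_le_iff₀ (by positivity)] at h
  rw [mul_comm 2, mul_comm 3]
  linarith

/-- A smooth cutoff equal to `1` on `(-∞, 4]` and to `0` on `[9, ∞)`. -/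
def cutoff (s : ℝ) : ℝ := Real.smoothTransition ((9 - s) / 5)

theorem contDiff_cutoff {n : ℕ∞} : ContDiff ℝ n cutoff :=
  Real.smoothTransition.contDiff.comp ((contDiff_const.sub contDiff_id).div_const 5)

theorem cutoff_nonneg (s : ℝ) : 0 ≤ cutoff s := Real.smoothTransition.nonneg _

theorem cutoff_of_le {s : ℝ} (hs : s ≤ 4) : cutoff s = 1 :=
  Real.smoothTransition.one_of_one_le (by linarith)

theorem cutoff_of_ge {s : ℝ} (hs : 9 ≤ s) : cutoff s = 0 :=
  Real.smoothTransition.zero_of_nonpos (by linarith)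

theorem deriv_cutoff_of_lt_or_gt {s : ℝ} (hs : s < 4 ∨ 9 < s) : deriv cutoff s = 0 := by
  rcases hs with hs | hs
  · have : cutoff =ᶠ[𝓝 s] fun _ => 1 := by
      filter_upwards [gt_mem_nhds hs] with t ht using cutoff_of_le (le_of_lt ht)
    rw [this.deriv_eq, deriv_const]
  · have : cutoff =ᶠ[𝓝 s] fun _ => 0 := by
      filter_upwards [lt_mem_nhds hs] with t ht using cutoff_of_ge (le_of_lt ht)
    rw [this.deriv_eq, deriv_const]

theorem deriv_deriv_cutoff_of_lt_or_gt {s : ℝ} (hs : s < 4 ∨ 9 < s) :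
    deriv (deriv cutoff) s = 0 := by
  have : deriv cutoff =ᶠ[𝓝 s] fun _ => 0 := by
    rcases hs with hs | hs
    · filter_upwards [gt_mem_nhds hs] with t ht using deriv_cutoff_of_lt_or_gt (Or.inl ht)
    · filter_upwards [lt_mem_nhds hs] with t ht using deriv_cutoff_of_lt_or_gt (Or.inr ht)
  rw [this.deriv_eq, deriv_const]

theorem contDiff_deriv_cutoff : ContDiff ℝ 1 (deriv cutoff) := by
  have h : ContDiff ℝ (1 + 1) cutoff := contDiff_cutoff (n := 2)
  exact (contDiff_succ_iff_deriv.1 h).2.2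

theorem hasDerivAt_cutoff_div (r t : ℝ) :
    HasDerivAt (fun t => cutoff (t / r ^ 2)) (deriv cutoff (t / r ^ 2) / r ^ 2) t := by
  have h := ((contDiff_cutoff (n := 1)).differentiable (by simp) (t / r ^ 2)).hasDerivAt
  simpa [Function.comp_def, div_eq_mul_inv] using h.comp t ((hasDerivAt_id t).div_const (r ^ 2))

theorem hasDerivAt_deriv_cutoff_div (r t : ℝ) :
    HasDerivAt (fun t => deriv cutoff (t / r ^ 2)) (deriv (deriv cutoff) (t / r ^ 2) / r ^ 2) t := by
  have h := (contDiff_deriv_cutoff.differentiable (by simp) (t / r ^ 2)).hasDerivAt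
  simpa [Function.comp_def, div_eq_mul_inv] using h.comp t ((hasDerivAt_id t).div_const (r ^ 2))

/-- The radial test function equal to `1` for `‖y‖ ≤ 2 * r` and to `0` for `3 * r ≤ ‖y‖`. -/
def radialCutoff (N : ℕ) (r : ℝ) (y : Euc N) : ℝ := cutoff (‖y‖ ^ 2 / r ^ 2)

theorem isC11c_radialCutoff (N : ℕ) {r : ℝ} (hr : 0 < r) : IsC11c (radialCutoff N r) := by
  have hd : ContDiff ℝ 2 (radialCutoff N r) :=
    (contDiff_cutoff (n := 2)).comp ((contDiff_id.norm_sq ℝ).div_const _)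
  have hc : HasCompactSupport (radialCutoff N r) := by
    refine HasCompactSupport.intro (isCompact_closedBall (0 : Euc N) (3 * r)) fun y hy => ?_
    rw [mem_closedBall_zero_iff, not_le] at hy
    refine cutoff_of_ge ?_
    rw [le_div_iff₀ (by positivity)]
    nlinarith
  exact ⟨hc, hd.differentiable (by simp), ContDiff.lipschitzWith_of_hasCompactSupport
    (hc.fderiv ℝ) (hd.fderiv_right (m := 1) (by norm_num)) (by simp)⟩

theorem LstarMu_radialCutoff {N : ℕ} (μ : ℝ) {r : ℝ} (hr : 0 < r) (y : Euc N) :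
    LstarMu N μ (radialCutoff N r) y =
      -(4 * ‖y‖ ^ 2 * (deriv (deriv cutoff) (‖y‖ ^ 2 / r ^ 2) / r ^ 4) +
        (4 + 4 * √(mu0 N - μ)) * (deriv cutoff (‖y‖ ^ 2 / r ^ 2) / r ^ 2)) := by
  have hξ : radialCutoff N r = fun y => (fun t => cutoff (t / r ^ 2)) (‖y - 0‖ ^ 2 + 0) := by
    ext y; simp [radialCutoff]
  rw [LstarMu, hξ, lap_radial 0 0 y (Eventually.of_forall fun t => hasDerivAt_cutoff_div r t)
    ((hasDerivAt_deriv_cutoff_div r _).div_const (r ^ 2)),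
    fderiv_radial_apply 0 0 y y (hasDerivAt_cutoff_div r _), sub_zero, add_zero,
    real_inner_self_eq_norm_sq, tauPlus]
  rcases eq_or_ne y 0 with rfl | hy
  · simp [deriv_cutoff_of_lt_or_gt (s := 0) (Or.inl (by norm_num))]
  · have := norm_pos_iff.2 hy
    field_simp
    ring

theorem LstarMu_radialCutoff_of_notMem_annulus {N : ℕ} (μ : ℝ) {r : ℝ} (hr : 0 < r) {y : Euc N}
    (hy : y ∉ annulus N (2 * r) (3 * r)) : LstarMu N μ (radialCutoff N r) y = 0 := by
  have h : ‖y‖ ^ 2 / r ^ 2 < 4 ∨ 9 < ‖y‖ ^ 2 / r ^ 2 := by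
    rw [mem_annulus, not_and_or, not_le, not_le] at hy
    rw [div_lt_iff₀ (by positivity), lt_div_iff₀ (by positivity)]
    rcases hy with h | h
    · left; nlinarith [norm_nonneg y]
    · right; nlinarith
  rw [LstarMu_radialCutoff μ hr, deriv_cutoff_of_lt_or_gt h, deriv_deriv_cutoff_of_lt_or_gt h]
  simp

theorem continuous_LstarMu_radialCutoff (N : ℕ) (μ : ℝ) {r : ℝ} (hr : 0 < r) :
    Continuous (LstarMu N μ (radialCutoff N r)) := by
  have h1 := contDiff_deriv_cutoff.continuous
  have h2 := contDiff_deriv_cutoff.continuous_deriv (by simp)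
  have : LstarMu N μ (radialCutoff N r) = _ := funext fun y => LstarMu_radialCutoff μ hr y
  rw [this]
  fun_prop

theorem exists_abs_LstarMu_radialCutoff_le (N : ℕ) (μ : ℝ) :
    ∃ K > 0, ∀ r > 0, ∀ y, |LstarMu N μ (radialCutoff N r) y| ≤ K * r⁻¹ ^ 2 := by
  obtain ⟨K₁, hK₁⟩ := (isCompact_Icc (a := (4 : ℝ)) (b := 9)).exists_bound_of_continuousOn
    contDiff_deriv_cutoff.continuous.continuousOn
  obtain ⟨K₂, hK₂⟩ := (isCompact_Icc (a := (4 : ℝ)) (b := 9)).exists_bound_of_continuousOn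
    (contDiff_deriv_cutoff.continuous_deriv (by simp)).continuousOn
  have hK₁0 : 0 ≤ K₁ := (norm_nonneg _).trans (hK₁ 4 (by norm_num))
  have hK₂0 : 0 ≤ K₂ := (norm_nonneg _).trans (hK₂ 4 (by norm_num))
  have hs := Real.sqrt_nonneg (mu0 N - μ)
  refine ⟨36 * K₂ + (4 + 4 * √(mu0 N - μ)) * K₁ + 1, by positivity, fun r hr y => ?_⟩
  by_cases hy : y ∈ annulus N (2 * r) (3 * r)
  · obtain ⟨h1, h2⟩ := mem_annulus.1 hy
    have hm : ‖y‖ ^ 2 / r ^ 2 ∈ Set.Icc 4 9 := by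
      constructor
      · rw [le_div_iff₀ (by positivity)]; nlinarith
      · rw [div_le_iff₀ (by positivity)]; nlinarith
    have h3 := hK₁ _ hm
    have h4 := hK₂ _ hm
    rw [Real.norm_eq_abs] at h3 h4
    rw [LstarMu_radialCutoff μ hr, abs_neg]
    set s := ‖y‖ ^ 2 / r ^ 2
    have h5 : 4 * ‖y‖ ^ 2 * (deriv (deriv cutoff) s / r ^ 4) +
        (4 + 4 * √(mu0 N - μ)) * (deriv cutoff s / r ^ 2) =
        (4 * s * deriv (deriv cutoff) s + (4 + 4 * √(mu0 N - μ)) * deriv cutoff s) * r⁻¹ ^ 2 := by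
      rw [show 4 * s * deriv (deriv cutoff) s = 4 * (‖y‖ ^ 2 / r ^ 2) * deriv (deriv cutoff) s
        from rfl]
      field_simp
    rw [h5, abs_mul, abs_of_nonneg (show 0 ≤ r⁻¹ ^ 2 by positivity)]
    refine mul_le_mul_of_nonneg_right ?_ (by positivity)
    refine (abs_add_le _ _).trans ?_
    rw [abs_mul, abs_mul, abs_mul, abs_of_nonneg (show 0 ≤ 4 + 4 * √(mu0 N - μ) by positivity),
      abs_of_nonneg (show 0 ≤ s by linarith [hm.1]), abs_of_pos (by norm_num : (0 : ℝ) < 4)]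
    have h6 : 4 * s * |deriv (deriv cutoff) s| ≤ 36 * K₂ :=
      mul_le_mul (by linarith [hm.2]) h4 (abs_nonneg _) (by norm_num)
    have h7 := mul_le_mul_of_nonneg_left h3 (show 0 ≤ 4 + 4 * √(mu0 N - μ) by positivity)
    linarith
  · rw [LstarMu_radialCutoff_of_notMem_annulus μ hr hy, abs_zero]
    positivity

theorem pow_mul_rpow_tauMinus_mul_rpow_tauPlus {N : ℕ} (hN : 3 ≤ N) (μ : ℝ) {t : ℝ} (ht : 0 < t) :
    t ^ (N - 1) * (t ^ tauMinus N μ * t ^ tauPlus N μ) = t := by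
  rw [← Real.rpow_natCast, ← Real.rpow_add ht, ← Real.rpow_add ht, Nat.cast_sub (by lia)]
  rw [show ((N : ℝ) - (1 : ℕ)) + (tauMinus N μ + tauPlus N μ) = 1 by
    simp only [tauMinus, tauPlus]; push_cast; ring, Real.rpow_one]

theorem integral_Ioi_radialCutoff (s : ℝ) {r : ℝ} (hr : 0 < r) :
    ∫ t in Set.Ioi (0 : ℝ), -(4 * t ^ 3 * (deriv (deriv cutoff) (t ^ 2 / r ^ 2) / r ^ 4) +
      (4 + 4 * s) * t * (deriv cutoff (t ^ 2 / r ^ 2) / r ^ 2)) = 2 * s := by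
  have h1 := contDiff_deriv_cutoff.continuous
  have h2 := contDiff_deriv_cutoff.continuous_deriv (by simp)
  have h0 := (contDiff_cutoff (n := 0)).continuous
  have hlarge {t : ℝ} (ht : 3 * r < |t|) : 9 < t ^ 2 / r ^ 2 := by
    rw [lt_div_iff₀ (by positivity), ← sq_abs t]
    nlinarith
  rw [integral_Ioi_of_hasDerivAt_of_tendsto (m := 0)
    (f := fun t => -(2 * t ^ 2 * (deriv cutoff (t ^ 2 / r ^ 2) / r ^ 2) +
      2 * s * cutoff (t ^ 2 / r ^ 2)))]
  · simp [cutoff_of_le]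
  · refine Continuous.continuousWithinAt ?_
    fun_prop
  · intro t _
    have hsq : HasDerivAt (fun t : ℝ => t ^ 2) (2 * t) t := by simpa using hasDerivAt_pow 2 t
    have d1 := (hasDerivAt_deriv_cutoff_div r (t ^ 2)).comp t hsq
    have d0 := (hasDerivAt_cutoff_div r (t ^ 2)).comp t hsq
    have h := (((hsq.const_mul 2).mul (d1.div_const (r ^ 2))).add (d0.const_mul (2 * s))).neg
    refine h.congr_deriv ?_
    simp only [Function.comp_apply]
    field_simp
    ring
  · refine (Continuous.integrable_of_hasCompactSupport (by fun_prop) ?_).integrableOn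
    refine HasCompactSupport.intro (isCompact_Icc (a := -(3 * r)) (b := 3 * r)) fun t ht => ?_
    have := hlarge (t := t) (by
      by_contra! h
      exact ht (abs_le.1 h))
    rw [deriv_cutoff_of_lt_or_gt (Or.inr this), deriv_deriv_cutoff_of_lt_or_gt (Or.inr this)]
    simp
  · refine tendsto_const_nhds.congr' ?_
    filter_upwards [eventually_gt_atTop (3 * r)] with t ht
    have := hlarge (ht.trans_le (le_abs_self t))
    rw [deriv_cutoff_of_lt_or_gt (Or.inr this), cutoff_of_ge this.le]
    simp

/-- The distributional identity of `‖·‖ ^ τ₋` tested against the radial cutoff. -/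
theorem integral_rpow_tauMinus_mul_LstarMu {N : ℕ} (hN : 3 ≤ N) {μ : ℝ} (hμ : μ < mu0 N) {r : ℝ}
    (hr : 0 < r) : ∫ y : Euc N, ‖y‖ ^ tauMinus N μ * LstarMu N μ (radialCutoff N r) y *
      ‖y‖ ^ tauPlus N μ = cMu N μ := by
  have : NeZero N := ⟨by lia⟩
  simp_rw [LstarMu_radialCutoff μ hr]
  rw [integral_fun_norm_addHaar volume (fun t => t ^ tauMinus N μ *
    -(4 * t ^ 2 * (deriv (deriv cutoff) (t ^ 2 / r ^ 2) / r ^ 4) +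
        (4 + 4 * √(mu0 N - μ)) * (deriv cutoff (t ^ 2 / r ^ 2) / r ^ 2)) * t ^ tauPlus N μ),
    setIntegral_congr_fun (g := fun t => -(4 * t ^ 3 *
      (deriv (deriv cutoff) (t ^ 2 / r ^ 2) / r ^ 4) +
      (4 + 4 * √(mu0 N - μ)) * t * (deriv cutoff (t ^ 2 / r ^ 2) / r ^ 2))) measurableSet_Ioi,
    integral_Ioi_radialCutoff _ hr, finrank_euclideanSpace_fin, cMu, if_pos hμ, sphereArea]
  · simp [Measure.real]
    ring
  · intro t ht
    have h := pow_mul_rpow_tauMinus_mul_rpow_tauPlus hN μ (Set.mem_Ioi.1 ht)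
    rw [finrank_euclideanSpace_fin]
    simp only [smul_eq_mul]
    linear_combination (-(4 * t ^ 2 * (deriv (deriv cutoff) (t ^ 2 / r ^ 2) / r ^ 4) +
      (4 + 4 * √(mu0 N - μ)) * (deriv cutoff (t ^ 2 / r ^ 2) / r ^ 2))) * h

theorem integrable_mul_LstarMu_radialCutoff {N : ℕ} (μ : ℝ) {r : ℝ} (hr : 0 < r) {w : Euc N → ℝ}
    (hw : ContDiffOn ℝ 2 w {x : Euc N | x ≠ 0}) :
    Integrable fun y => w y * LstarMu N μ (radialCutoff N r) y * ‖y‖ ^ tauPlus N μ := by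
  have hr2 : 0 < 2 * r := by positivity
  rw [← integrableOn_iff_integrable_of_support_subset (s := annulus N (2 * r) (3 * r))]
  · refine ContinuousOn.integrableOn_compact (isCompact_annulus N _ _) ?_
    refine ((continuousOn_annulus hw hr2).mul
      (continuous_LstarMu_radialCutoff N μ hr).continuousOn).mul ?_
    refine continuous_norm.continuousOn.rpow_const fun y hy => Or.inl ?_
    exact norm_ne_zero_iff.2 (annulus_subset_ne_zero hr2 hy)
  · intro y hy
    by_contra h
    exact hy (by simp [LstarMu_radialCutoff_of_notMem_annulus μ hr h])

/-- A nonnegative function on the punctured space is tested against the radial cutoff up to its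
mass on an annulus. -/
theorem exists_integral_mul_LstarMu_radialCutoff_le (N : ℕ) {μ : ℝ} (hτ : tauPlus N μ ≤ 0) :
    ∃ K > 0, ∀ r > 0, ∀ w : Euc N → ℝ, ContDiffOn ℝ 2 w {x : Euc N | x ≠ 0} →
      (∀ y, y ≠ 0 → 0 ≤ w y) →
      ∫ y, w y * LstarMu N μ (radialCutoff N r) y * ‖y‖ ^ tauPlus N μ ≤
        K * r⁻¹ ^ 2 * r ^ tauPlus N μ * ∫ y in annulus N (2 * r) (3 * r), w y := by
  obtain ⟨K, hK, H⟩ := exists_abs_LstarMu_radialCutoff_le N μ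
  refine ⟨K, hK, fun r hr w hw hw0 => ?_⟩
  have hr2 : 0 < 2 * r := by positivity
  rw [← setIntegral_eq_integral_of_forall_compl_eq_zero (s := annulus N (2 * r) (3 * r))
    fun y hy => by simp [LstarMu_radialCutoff_of_notMem_annulus μ hr hy], ← integral_const_mul]
  refine setIntegral_mono_on (integrable_mul_LstarMu_radialCutoff μ hr hw).integrableOn
    (((continuousOn_annulus hw hr2).integrableOn_compact (isCompact_annulus N _ _)).const_mul _)
    (measurableSet_annulus N _ _) fun y hy => ?_
  have hy0 := hw0 y (annulus_subset_ne_zero hr2 hy)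
  have h1 : ‖y‖ ^ tauPlus N μ ≤ r ^ tauPlus N μ :=
    Real.rpow_le_rpow_of_nonpos hr (by linarith [(mem_annulus.1 hy).1]) hτ
  have h2 := (le_abs_self _).trans (H r hr y)
  calc w y * LstarMu N μ (radialCutoff N r) y * ‖y‖ ^ tauPlus N μ
      ≤ w y * (K * r⁻¹ ^ 2) * r ^ tauPlus N μ := by gcongr
    _ = K * r⁻¹ ^ 2 * r ^ tauPlus N μ * w y := by ring

theorem cMu_pos {N : ℕ} (hN : 3 ≤ N) {μ : ℝ} (hμ : μ < mu0 N) : 0 < cMu N μ := by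
  have h1 : 0 < √(mu0 N - μ) := Real.sqrt_pos.2 (by linarith)
  have h2 : 0 < (volume (ball (0 : Euc N) 1)).toReal :=
    ENNReal.toReal_pos (measure_ball_pos volume 0 one_pos).ne' measure_ball_lt_top.ne
  have h3 : (0 : ℝ) < N := by exact_mod_cast (by lia : 0 < N)
  rw [cMu, if_pos hμ, sphereArea]
  positivity

theorem tauPlus_nonpos {N : ℕ} (hN : 3 ≤ N) {μ : ℝ} (hμ : 0 < μ) : tauPlus N μ ≤ 0 := by
  have h3 : (3 : ℝ) ≤ N := by exact_mod_cast hN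
  have h : √(mu0 N - μ) ≤ (N - 2) / 2 := by
    rw [Real.sqrt_le_left (by linarith), mu0]
    nlinarith
  rw [tauPlus]
  linarith

/-- The mass at the origin is controlled from above by testing against the radial cutoff. -/
theorem DistribIdentity.le_integral {N : ℕ} (hN : 3 ≤ N) {μ : ℝ} (hμ : 0 < μ) (hμ0 : μ < mu0 N)
    {V u : Euc N → ℝ} (hV : ∀ x : Euc N, x ≠ 0 → ‖x‖ ^ (-2 : ℝ) ≤ V x)
    (hu : ContDiffOn ℝ 2 u {x : Euc N | x ≠ 0}) (hu0 : ∀ x : Euc N, x ≠ 0 → 0 ≤ u x)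
    {k : ℝ} (hk : 0 < k) (hid : DistribIdentity N μ V u k) {r : ℝ} (hr : 0 < r) :
    cMu N μ * k ≤
      ∫ y, u y * LstarMu N μ (radialCutoff N r) y * ‖y‖ ^ tauPlus N μ := by
  have : NeZero N := ⟨by lia⟩
  have h := hid _ (isC11c_radialCutoff N hr)
  have h0 : radialCutoff N r 0 = 1 := by simp [radialCutoff, cutoff_of_le]
  have hc := mul_pos (cMu_pos hN hμ0) hk
  rw [h0, mul_one] at h
  rw [← h]
  refine integral_mono_ae (not_imp_comm.1 integral_undef (h ▸ hc.ne'))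
    (integrable_mul_LstarMu_radialCutoff μ hr hu) ?_
  filter_upwards [Measure.ae_ne volume 0] with y hy
  refine mul_le_mul_of_nonneg_right (mul_le_mul_of_nonneg_left ?_ (hu0 y hy)) (by positivity)
  rw [LstarMuV]
  have := mul_nonneg (mul_nonneg hμ.le (sub_nonneg.2 (hV y hy)))
    (cutoff_nonneg (‖y‖ ^ 2 / r ^ 2))
  rw [radialCutoff]
  linarith

theorem contDiffOn_norm_rpow (N : ℕ) (τ : ℝ) :
    ContDiffOn ℝ 2 (fun y : Euc N => ‖y‖ ^ τ) {x : Euc N | x ≠ 0} := fun _ hx =>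
  ((contDiffAt_norm ℝ hx).rpow_const_of_ne (norm_ne_zero_iff.2 hx)).contDiffWithinAt

theorem lap_norm_rpow {N : ℕ} (τ : ℝ) {x : Euc N} (hx : x ≠ 0) :
    lap (fun y => ‖y‖ ^ τ) x = τ * (τ + N - 2) * (‖x‖ ^ (-2 : ℝ) * ‖x‖ ^ τ) := by
  have hr := norm_pos_iff.2 hx
  have h : (fun y : Euc N => ‖y‖ ^ τ) = fun y => (‖y - 0‖ ^ 2 + 0) ^ (τ / 2) := by
    ext y
    rw [sub_zero, add_zero, ← Real.rpow_natCast, ← Real.rpow_mul (norm_nonneg y)]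
    congr 1
    push_cast
    ring
  have hpow (q : ℝ) : (‖x‖ ^ 2) ^ q = ‖x‖ ^ (2 * q) := by
    rw [← Real.rpow_natCast, ← Real.rpow_mul (norm_nonneg x)]
    push_cast
    rfl
  have h2 : (‖x‖ ^ 2) ^ (τ / 2 - 1) = ‖x‖ ^ (-2 : ℝ) * ‖x‖ ^ τ := by
    rw [hpow, ← Real.rpow_add hr]
    congr 1
    ring
  have h3 : ‖x‖ ^ 2 * (‖x‖ ^ 2) ^ (τ / 2 - 2) = ‖x‖ ^ (-2 : ℝ) * ‖x‖ ^ τ := by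
    rw [← h2, mul_comm, ← Real.rpow_add_one (by positivity)]
    congr 1
    ring
  rw [h, lap_rpow 0 0 (τ / 2) x (by rw [sub_zero, add_zero]; positivity), sub_zero, add_zero,
    h2]
  linear_combination (τ * (τ - 2)) * h3

theorem tauMinus_mul {N : ℕ} {μ : ℝ} (hμ0 : μ < mu0 N) :
    tauMinus N μ * (tauMinus N μ + N - 2) = -μ := by
  have h := Real.sq_sqrt (show 0 ≤ mu0 N - μ by linarith)
  have h2 : mu0 N = ((N : ℝ) - 2) ^ 2 / 4 := rfl
  rw [tauMinus]
  linear_combination h + h2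

/-- A lower bound `m * ‖·‖ ^ τ₋` with `m < k` can be improved by a definite fraction of `k - m`. -/
theorem exists_improve_lower_bound
    {N : ℕ} (hN : 3 ≤ N) {μ : ℝ} (hμ : 0 < μ) (hμ0 : μ < mu0 N) {V u : Euc N → ℝ}
    (hV : ∀ x : Euc N, x ≠ 0 → ‖x‖ ^ (-2 : ℝ) ≤ V x) (hu : IsSolution N μ V u)
    (hu0 : ∀ x : Euc N, x ≠ 0 → 0 ≤ u x) {k : ℝ} (hk : 0 < k) (hid : DistribIdentity N μ V u k) :
    ∃ c > 0, ∀ m : ℝ, (∀ x : Euc N, x ≠ 0 → m * ‖x‖ ^ tauMinus N μ ≤ u x) →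
      ∀ x : Euc N, x ≠ 0 → (m + c * (k - m)) * ‖x‖ ^ tauMinus N μ ≤ u x := by
  obtain ⟨C, hC, hHarnack⟩ := exists_annulus_integral_le N hN
  obtain ⟨K, hK, hupper⟩ := exists_integral_mul_LstarMu_radialCutoff_le N (tauPlus_nonpos hN hμ)
  have hcμ := cMu_pos hN hμ0
  refine ⟨cMu N μ / (K * C), by positivity, fun m hm x hx => ?_⟩
  have hr := norm_pos_iff.2 hx
  have hΦ := contDiffOn_norm_rpow N (tauMinus N μ)
  set w : Euc N → ℝ := fun y => u y - m * ‖y‖ ^ tauMinus N μ with hw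
  have hwc : ContDiffOn ℝ 2 w {x : Euc N | x ≠ 0} := hu.1.sub (contDiffOn_const.mul hΦ)
  have hw0 (y : Euc N) (hy : y ≠ 0) : 0 ≤ w y := sub_nonneg.2 (hm y hy)
  have hlap (y : Euc N) (hy : y ≠ 0) : lap w y ≤ 0 := by
    have hmem := isOpen_ne.mem_nhds hy
    rw [hw, lap_sub_const_mul (hu.1.contDiffAt hmem) (hΦ.contDiffAt hmem), lap_norm_rpow _ hy,
      tauMinus_mul hμ0]
    have h1 := hu.2 y hy
    have h2 := mul_nonneg (mul_nonneg hμ.le (sub_nonneg.2 (hV y hy))) (hu0 y hy)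
    have h3 := mul_nonneg (mul_nonneg hμ.le (Real.rpow_nonneg (norm_nonneg y) (-2))) (hw0 y hy)
    simp only [hw] at h3
    linarith
  have hlower : cMu N μ * (k - m) ≤
      ∫ y, w y * LstarMu N μ (radialCutoff N ‖x‖) y * ‖y‖ ^ tauPlus N μ := by
    have h1 := hid.le_integral hN hμ hμ0 hV hu.1 hu0 hk hr
    have h2 := integral_rpow_tauMinus_mul_LstarMu hN hμ0 hr
    simp_rw [hw, sub_mul, mul_assoc m]
    rw [integral_sub (integrable_mul_LstarMu_radialCutoff μ hr hu.1)
      ((integrable_mul_LstarMu_radialCutoff μ hr hΦ).const_mul m), integral_const_mul, h2]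
    linarith
  have hrpow : ‖x‖⁻¹ ^ 2 * ‖x‖ ^ tauPlus N μ * ‖x‖ ^ N * ‖x‖ ^ tauMinus N μ = 1 := by
    rw [inv_pow, ← Real.rpow_natCast, ← Real.rpow_natCast, ← Real.rpow_neg hr.le,
      ← Real.rpow_add hr, ← Real.rpow_add hr, ← Real.rpow_add hr]
    rw [show -((2 : ℕ) : ℝ) + tauPlus N μ + N + tauMinus N μ = 0 by
      simp only [tauMinus, tauPlus]; push_cast; ring, Real.rpow_zero]
  have h1 : cMu N μ * (k - m) ≤
      K * ‖x‖⁻¹ ^ 2 * ‖x‖ ^ tauPlus N μ * (C * ‖x‖ ^ N * w x) :=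
    (hlower.trans (hupper ‖x‖ hr w hwc hw0)).trans
      (mul_le_mul_of_nonneg_left (hHarnack w hwc hw0 hlap x hx) (by positivity))
  have h2 : cMu N μ * (k - m) * ‖x‖ ^ tauMinus N μ ≤ K * C * w x :=
    calc cMu N μ * (k - m) * ‖x‖ ^ tauMinus N μ
        ≤ K * ‖x‖⁻¹ ^ 2 * ‖x‖ ^ tauPlus N μ * (C * ‖x‖ ^ N * w x) * ‖x‖ ^ tauMinus N μ := by gcongr
      _ = K * C * w x := by linear_combination (K * C * w x) * hrpow
  have h3 : cMu N μ / (K * C) * (k - m) * ‖x‖ ^ tauMinus N μ ≤ w x := by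
    rw [div_mul_eq_mul_div, div_mul_eq_mul_div, div_le_iff₀' (by positivity)]
    exact h2
  simp only [hw] at h3
  linarith

/-- Proposition 1.1, last part: a nonnegative dμ-distributional solution with k > 0
dominates kΦ_μ. -/
theorem solution_dominates_Phi
    (N : ℕ) (hN : 3 ≤ N) (μ : ℝ) (hμ : 0 < μ) (hμ0 : μ < mu0 N)
    (γ : ℝ) (hγ : 0 < γ ∧ γ < 1) (V : Euc N → ℝ)
    (hVreg : LocHolderOn γ {x : Euc N | x ≠ 0} V)
    (hVpos : ∀ x : Euc N, x ≠ 0 → 0 < V x)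
    (hVlower : ∀ x : Euc N, x ≠ 0 → ‖x‖ ^ (-2 : ℝ) ≤ V x)
    (hVlim : Tendsto (fun x : Euc N => V x * ‖x‖ ^ 2)
      (nhdsWithin (0 : Euc N) {x : Euc N | x ≠ 0}) (nhds 1))
    (u : Euc N → ℝ) (hu : IsSolution N μ V u)
    (hunn : ∀ x : Euc N, x ≠ 0 → 0 ≤ u x)
    (k : ℝ) (hk : 0 < k) (hid : DistribIdentity N μ V u k) :
    ∀ x : Euc N, x ≠ 0 → k * ‖x‖ ^ tauMinus N μ ≤ u x := by
  obtain ⟨c, hc, H⟩ := exists_improve_lower_bound hN hμ hμ0 hVlower hu hunn hk hid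
  set S : Set ℝ := {m | ∀ x : Euc N, x ≠ 0 → m * ‖x‖ ^ tauMinus N μ ≤ u x}
  have h0 : (0 : ℝ) ∈ S := fun x hx => by simpa using hunn x hx
  have hle {m : ℝ} (hm : m ∈ S) {x : Euc N} (hx : x ≠ 0) : m ≤ u x / ‖x‖ ^ tauMinus N μ :=
    (le_div_iff₀ (Real.rpow_pos_of_pos (norm_pos_iff.2 hx) _)).2 (hm x hx)
  have hsup : sSup S ∈ S := fun x hx =>
    (le_div_iff₀ (Real.rpow_pos_of_pos (norm_pos_iff.2 hx) _)).1
      (csSup_le ⟨0, h0⟩ fun m hm => hle hm hx)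
  intro x hx
  have hbdd : BddAbove S := ⟨_, fun m hm => hle hm hx⟩
  have hkS : k ≤ sSup S := by
    by_contra! h
    have h1 := le_csSup hbdd (H _ hsup)
    nlinarith
  exact (mul_le_mul_of_nonneg_right hkS (by positivity)).trans (hsup x hx)
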